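/- There exists a constant C > 0 such that for every t ∈ (0,1] and every α ∈ (1,2), ∫_0^t (t-s)^{-1/α} · s^{-1/2} · ( 3-α − s^{1-α/2}/(3-α) ) ds ≤ (C/(α-1)) · (2-α) · t^{-1/α + 1/2} · (1 + log(1/t)). -/

import Mathlib

open MeasureTheory Real

/-- Splitting a Beta kernel at the midpoint of `(0, t)`. -/
lemma rpow_neg_mul_rpow_neg_le {t s a b : ℝ} (hs : 0 < s) (hst : s < t)
    (ha : 0 ≤ a) (hb : 0 ≤ b) :
    (t - s) ^ (-a) * s ^ (-b) ≤ (t / 2) ^ (-a) * s ^ (-b) + (t / 2) ^ (-b) * (t - s) ^ (-a) := by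
  have ht : 0 < t / 2 := by linarith
  have hts : 0 < t - s := by linarith
  have h1 := rpow_pos_of_pos hts (-a)
  have h2 := rpow_pos_of_pos hs (-b)
  have h3 := rpow_pos_of_pos ht (-a)
  have h4 := rpow_pos_of_pos ht (-b)
  rcases le_total s (t / 2) with h | h
  · have : (t - s) ^ (-a) ≤ (t / 2) ^ (-a) :=
      rpow_le_rpow_of_nonpos ht (by linarith) (by linarith)
    nlinarith [mul_le_mul_of_nonneg_right this h2.le, mul_pos h4 h1]
  · have : s ^ (-b) ≤ (t / 2) ^ (-b) := rpow_le_rpow_of_nonpos ht h (by linarith)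
    nlinarith [mul_le_mul_of_nonneg_left this h1.le, mul_pos h3 h2]

lemma sub_rpow_div_nonneg {s u : ℝ} (hs : 0 < s) (hs1 : s ≤ 1) (hu : 0 ≤ u) :
    0 ≤ 1 + u - s ^ (u / 2) / (1 + u) := by
  have h1 : s ^ (u / 2) ≤ 1 := rpow_le_one hs.le hs1 (by linarith)
  have h2 : s ^ (u / 2) / (1 + u) ≤ 1 := by
    rw [div_le_one (by linarith)]; linarith
  linarith

lemma sub_rpow_div_le_mul_log {s u : ℝ} (hs : 0 < s) (hs1 : s ≤ 1) (hu : 0 ≤ u) :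
    1 + u - s ^ (u / 2) / (1 + u) ≤ u * (2 + log (1 / s) / 2) := by
  have hL : 0 ≤ log (1 / s) := log_nonneg (by rw [le_div_iff₀ hs]; linarith)
  have h1 : 1 - u / 2 * log (1 / s) ≤ s ^ (u / 2) := by
    rw [rpow_def_of_pos hs, one_div, log_inv]
    linarith [add_one_le_exp (log s * (u / 2))]
  have hu1 : 0 < 1 + u := by linarith
  have h2 : 1 + u - u * (2 + log (1 / s) / 2) ≤ s ^ (u / 2) / (1 + u) := by
    rw [le_div_iff₀ hu1]
    nlinarith [mul_nonneg (mul_nonneg hu hu) hL, mul_nonneg hu hu]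
  linarith

lemma sub_rpow_div_le_mul_rpow {s t u : ℝ} (hs : 0 < s) (hst : s < t) (ht1 : t ≤ 1)
    (hu : 0 ≤ u) :
    1 + u - s ^ (u / 2) / (1 + u) ≤ 4 * u * (1 + log (1 / t)) * (t / s) ^ (1 / 4 : ℝ) := by
  have ht : 0 < t := hs.trans hst
  have hl : 0 ≤ log (1 / t) := log_nonneg (by rw [le_div_iff₀ ht]; linarith)
  have h1 : 1 ≤ (t / s) ^ (1 / 4 : ℝ) :=
    one_le_rpow (by rw [le_div_iff₀ hs]; linarith) (by norm_num)
  have h2 : log (t / s) ≤ (t / s) ^ (1 / 4 : ℝ) / (1 / 4) :=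
    log_le_rpow_div (by positivity) (by norm_num)
  have h3 : log (1 / s) = log (1 / t) + log (t / s) := by
    rw [← log_mul (by positivity) (by positivity)]
    congr 1
    field_simp
  refine (sub_rpow_div_le_mul_log hs (by linarith) hu).trans ?_
  have h4 : 2 + log (1 / s) / 2 ≤ 4 * (1 + log (1 / t)) * (t / s) ^ (1 / 4 : ℝ) := by
    rw [h3]
    nlinarith [mul_le_mul_of_nonneg_left h1 hl]
  calc u * (2 + log (1 / s) / 2) ≤ u * (4 * (1 + log (1 / t)) * (t / s) ^ (1 / 4 : ℝ)) :=
        mul_le_mul_of_nonneg_left h4 hu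
    _ = _ := by ring

lemma integrableOn_and_integral_Ioo_rpow_neg {t b : ℝ} (ht : 0 < t) (hb : b < 1) :
    IntegrableOn (fun s : ℝ => s ^ (-b)) (Set.Ioo 0 t) ∧
      ∫ s in Set.Ioo 0 t, s ^ (-b) = t ^ (1 - b) / (1 - b) := by
  constructor
  · rw [← intervalIntegrable_iff_integrableOn_Ioo_of_le ht.le]
    exact intervalIntegral.intervalIntegrable_rpow' (by linarith)
  · rw [← integral_Ioc_eq_integral_Ioo, ← intervalIntegral.integral_of_le ht.le,
      integral_rpow (Or.inl (by linarith)), show -b + 1 = 1 - b by ring,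
      zero_rpow (by linarith), sub_zero]

lemma integrableOn_and_integral_Ioo_sub_rpow_neg {t a : ℝ} (ht : 0 < t) (ha : a < 1) :
    IntegrableOn (fun s : ℝ => (t - s) ^ (-a)) (Set.Ioo 0 t) ∧
      ∫ s in Set.Ioo 0 t, (t - s) ^ (-a) = t ^ (1 - a) / (1 - a) := by
  constructor
  · rw [← intervalIntegrable_iff_integrableOn_Ioo_of_le ht.le]
    have h := (intervalIntegral.intervalIntegrable_rpow' (a := 0) (b := t) (r := -a)
      (by linarith)).comp_sub_left t
    simpa using h.symm
  · rw [← integral_Ioc_eq_integral_Ioo, ← intervalIntegral.integral_of_le ht.le,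
      intervalIntegral.integral_comp_sub_left (fun x : ℝ => x ^ (-a)) t, sub_self, sub_zero,
      integral_rpow (Or.inl (by linarith)), show -a + 1 = 1 - a by ring,
      zero_rpow (by linarith), sub_zero]

theorem stmt6 :
    ∃ C : ℝ, 0 < C ∧ ∀ t : ℝ, 0 < t → t ≤ 1 → ∀ α : ℝ, 1 < α → α < 2 →
      (∫ s in Set.Ioo (0 : ℝ) t,
          (t - s) ^ (-(1 / α)) * s ^ (-(1 / 2 : ℝ)) *
            (3 - α - s ^ (1 - α / 2) / (3 - α))) ≤
        C / (α - 1) * (2 - α) * t ^ (-(1 / α) + 1 / 2) * (1 + Real.log (1 / t)) := by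
  refine ⟨48, by norm_num, fun t ht ht1 α hα1 hα2 => ?_⟩
  have hα0 : 0 < α := by linarith
  have ha0 : 0 ≤ 1 / α := by positivity
  have ha1 : 1 / α < 1 := by rw [div_lt_one hα0]; exact hα1
  have hu : 0 ≤ 2 - α := by linarith
  have hl : 0 ≤ log (1 / t) := log_nonneg (by rw [le_div_iff₀ ht]; linarith)
  obtain ⟨hi1, he1⟩ := integrableOn_and_integral_Ioo_rpow_neg (b := 3 / 4) ht (by norm_num)
  obtain ⟨hi2, he2⟩ := integrableOn_and_integral_Ioo_sub_rpow_neg ht ha1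
  have hfac : ∀ s : ℝ, 3 - α - s ^ (1 - α / 2) / (3 - α) =
      1 + (2 - α) - s ^ ((2 - α) / 2) / (1 + (2 - α)) := by
    intro s
    rw [show 1 + (2 - α) = 3 - α by ring, show (2 - α) / 2 = 1 - α / 2 by ring]
  simp_rw [hfac]
  set K : ℝ := 4 * (2 - α) * (1 + log (1 / t)) with hK
  have hK0 : 0 ≤ K := by positivity
  have hA := hi1.const_mul ((t / 2) ^ (-(1 / α)))
  have hB := hi2.const_mul ((t / 2) ^ (-(3 / 4 : ℝ)))
  have hmono : (∫ s in Set.Ioo (0 : ℝ) t, (t - s) ^ (-(1 / α)) * s ^ (-(1 / 2 : ℝ)) *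
        (1 + (2 - α) - s ^ ((2 - α) / 2) / (1 + (2 - α)))) ≤
      ∫ s in Set.Ioo (0 : ℝ) t, K * t ^ (1 / 4 : ℝ) *
        ((t / 2) ^ (-(1 / α)) * s ^ (-(3 / 4 : ℝ)) +
          (t / 2) ^ (-(3 / 4 : ℝ)) * (t - s) ^ (-(1 / α))) := by
    refine integral_mono_of_nonneg ?_ ((hA.add hB).const_mul _) ?_
    · filter_upwards [ae_restrict_mem measurableSet_Ioo] with s hs
      have hts : 0 ≤ t - s := by linarith [hs.2]
      exact mul_nonneg (mul_nonneg (rpow_nonneg hts _) (rpow_nonneg hs.1.le _))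
        (sub_rpow_div_nonneg hs.1 (by linarith [hs.2]) hu)
    · filter_upwards [ae_restrict_mem measurableSet_Ioo] with s hs
      have hts : 0 ≤ t - s := by linarith [hs.2]
      have hs0 : 0 < s := hs.1
      have hsplit : s ^ (-(1 / 2 : ℝ)) * (t / s) ^ (1 / 4 : ℝ) =
          t ^ (1 / 4 : ℝ) * s ^ (-(3 / 4 : ℝ)) := by
        rw [div_rpow ht.le hs0.le, div_eq_mul_inv (t ^ (1 / 4 : ℝ)), ← rpow_neg hs0.le, mul_left_comm,
          ← rpow_add hs0]
        norm_num
      calc (t - s) ^ (-(1 / α)) * s ^ (-(1 / 2 : ℝ)) *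
            (1 + (2 - α) - s ^ ((2 - α) / 2) / (1 + (2 - α)))
          ≤ (t - s) ^ (-(1 / α)) * s ^ (-(1 / 2 : ℝ)) * (K * (t / s) ^ (1 / 4 : ℝ)) :=
            mul_le_mul_of_nonneg_left (sub_rpow_div_le_mul_rpow hs0 hs.2 ht1 hu)
              (mul_nonneg (rpow_nonneg hts _) (rpow_nonneg hs0.le _))
        _ = K * (t - s) ^ (-(1 / α)) * (s ^ (-(1 / 2 : ℝ)) * (t / s) ^ (1 / 4 : ℝ)) := by ring
        _ = K * t ^ (1 / 4 : ℝ) * ((t - s) ^ (-(1 / α)) * s ^ (-(3 / 4 : ℝ))) := by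
            rw [hsplit]; ring
        _ ≤ _ := mul_le_mul_of_nonneg_left
            (rpow_neg_mul_rpow_neg_le hs0 hs.2 ha0 (by norm_num)) (by positivity)
  refine hmono.trans ?_
  rw [integral_const_mul, integral_add hA hB, integral_const_mul, integral_const_mul, he1, he2]
  have h2 : ∀ c : ℝ, (t / 2) ^ (-c) = 2 ^ c * t ^ (-c) := by
    intro c
    rw [div_rpow ht.le (by norm_num), rpow_neg (by norm_num : (0 : ℝ) ≤ 2), div_inv_eq_mul,
      mul_comm]
  have hc : ∀ c : ℝ, c ≤ 1 → (2 : ℝ) ^ c ≤ 2 := fun c hc => by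
    simpa using rpow_le_rpow_of_exponent_le (by norm_num : (1 : ℝ) ≤ 2) hc
  have hp1 : t ^ (1 / 4 : ℝ) * (t ^ (-(1 / α)) * t ^ (1 - 3 / 4 : ℝ)) =
      t ^ (-(1 / α) + 1 / 2) := by
    rw [← rpow_add ht, ← rpow_add ht]
    congr 1
    ring
  have hp2 : t ^ (1 / 4 : ℝ) * (t ^ (-(3 / 4 : ℝ)) * t ^ (1 - 1 / α)) =
      t ^ (-(1 / α) + 1 / 2) := by
    rw [← rpow_add ht, ← rpow_add ht]
    congr 1
    ring
  have hinv : 1 / (1 - 1 / α) ≤ 2 / (α - 1) := by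
    have : 1 - 1 / α = (α - 1) / α := by field_simp
    rw [this, one_div_div]
    exact div_le_div_of_nonneg_right hα2.le (by linarith)
  have hinv1 : 1 ≤ 1 / (α - 1) := by
    rw [le_div_iff₀ (by linarith)]; linarith
  have hcoef : 2 ^ (1 / α) * 4 + 2 ^ (3 / 4 : ℝ) * (1 / (1 - 1 / α)) ≤ 12 / (α - 1) := by
    have h3 : (2 : ℝ) ^ (3 / 4 : ℝ) * (1 / (1 - 1 / α)) ≤ 2 * (2 / (α - 1)) :=
      mul_le_mul (hc _ (by norm_num)) hinv (by
        rw [one_div_nonneg]; linarith) (by norm_num)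
    have h4 := hc _ ha1.le
    rw [show 2 * (2 / (α - 1)) = 4 * (1 / (α - 1)) by ring] at h3
    rw [show 12 / (α - 1) = 12 * (1 / (α - 1)) by ring]
    linarith
  rw [h2, h2]
  calc _ = K * ((t ^ (1 / 4 : ℝ) * (t ^ (-(1 / α)) * t ^ (1 - 3 / 4 : ℝ))) * (2 ^ (1 / α) * 4) +
        (t ^ (1 / 4 : ℝ) * (t ^ (-(3 / 4 : ℝ)) * t ^ (1 - 1 / α))) *
          (2 ^ (3 / 4 : ℝ) * (1 / (1 - 1 / α)))) := by ring
    _ = K * t ^ (-(1 / α) + 1 / 2) *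
        (2 ^ (1 / α) * 4 + 2 ^ (3 / 4 : ℝ) * (1 / (1 - 1 / α))) := by
        rw [hp1, hp2]; ring
    _ ≤ K * t ^ (-(1 / α) + 1 / 2) * (12 / (α - 1)) :=
        mul_le_mul_of_nonneg_left hcoef (by positivity)
    _ = _ := by rw [hK]; ring
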